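/- arXiv:2603.07869 — 3 statements merged into one kernel-verified Lean document; each statement's English description precedes it below -/
import Mathlib

section
/- Let K ⊆ C be fields of characteristic zero, let G be a group acting on C by K-algebra automorphisms with fixed field C^G = K, and let λ : G → (K,+) be a group homomorphism with the property that whenever elements c, v ∈ C satisfy g(v) − v = c·λ(g) for all g ∈ G, then c = 0. Extend the G-action from C to the polynomial ring C[X] by letting g ∈ G act on coefficients and send X to X + λ(g), i.e. g·(∑ aᵢXⁱ) = ∑ g(aᵢ)(X+λ(g))ⁱ. Then the G-fixed points of C[X] are exactly the constant polynomials with coefficients in K. -/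
open Polynomial

/-- The twisted action of a `K`-algebra automorphism `σ` of `C` together with a
translation parameter `t` on the polynomial ring `C[X]`:
`∑ aᵢ Xⁱ ↦ ∑ σ(aᵢ) (X + t)ⁱ`. -/
noncomputable def polyAct {K C : Type*} [Field K] [Field C] [Algebra K C]
    (σ : C ≃ₐ[K] C) (t : C) (q : Polynomial C) : Polynomial C :=
  (q.map (σ : C →+* C)).comp (Polynomial.X + Polynomial.C t)

/-- The subleading coefficient of a Taylor shift. -/
theorem Polynomial.coeff_taylor_of_natDegree_le_succ {R : Type*} [CommSemiring R] {p : R[X]}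
    {n : ℕ} (hp : p.natDegree ≤ n + 1) (t : R) :
    (taylor t p).coeff n = p.coeff n + (n + 1) * p.coeff (n + 1) * t := by
  have hdeg : (hasseDeriv n p).natDegree < 2 := by
    have := natDegree_hasseDeriv_le p n
    omega
  rw [taylor_coeff, eval_eq_sum_range' hdeg, Finset.sum_range_succ, Finset.sum_range_one,
    hasseDeriv_coeff, hasseDeriv_coeff, Nat.add_comm 1 n, Nat.choose_succ_self_right]
  simp

theorem polyAct_eq_taylor {K C : Type*} [Field K] [Field C] [Algebra K C]
    (σ : C ≃ₐ[K] C) (t : C) (q : C[X]) :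
    polyAct σ t q = taylor t (q.map (σ : C →+* C)) := rfl

/-- Let `K ⊆ C` be fields of characteristic zero, `G` a group acting on `C` by
`K`-algebra automorphisms with fixed field `C^G = K`, and `λ : G → (K,+)` a group
homomorphism such that `c·λ` is never a nonzero coboundary (i.e. whenever
`g(v) − v = c·λ(g)` for all `g`, then `c = 0`).  Extend the `G`-action to `C[X]` by
`g·(∑ aᵢXⁱ) = ∑ g(aᵢ)(X+λ(g))ⁱ`.  Then the `G`-fixed points of `C[X]` are exactly the
constant polynomials with coefficients in `K`. -/
theorem deRham_flipflop_stmt0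
    {K C : Type*} [Field K] [Field C] [CharZero K] [CharZero C] [Algebra K C]
    {G : Type*} [Group G]
    (ρ : G →* (C ≃ₐ[K] C))
    (hfix : ∀ c : C, (∀ g : G, ρ g c = c) ↔ c ∈ Set.range (algebraMap K C))
    (l : G → K)
    (hl : ∀ g h : G, l (g * h) = l g + l h)
    (hcob : ∀ c v : C, (∀ g : G, ρ g v - v = c * algebraMap K C (l g)) → c = 0)
    (q : Polynomial C) :
    (∀ g : G, polyAct (ρ g) (algebraMap K C (l g)) q = q) ↔
      ∃ a : K, q = Polynomial.C (algebraMap K C a) := by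
  constructor
  · intro h
    have hdeg : q.natDegree = 0 := by
      by_contra hne
      obtain ⟨n, hn⟩ := Nat.exists_eq_succ_of_ne_zero hne
      have hmap (g : G) : (q.map (ρ g : C →+* C)).natDegree = n + 1 := by
        rw [natDegree_map, hn]
      have hlead (g : G) : ρ g (q.coeff (n + 1)) = q.coeff (n + 1) := by
        have hg := coeff_taylor_natDegree (algebraMap K C (l g)) (q.map (ρ g : C →+* C))
        rw [← polyAct_eq_taylor, h g, leadingCoeff, hmap g, coeff_map] at hg
        exact hg.symm
      have hzero := hcob (-((n + 1) * q.coeff (n + 1))) (q.coeff n) fun g => by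
        have hg := congrArg (coeff · n) (h g)
        simp only [polyAct_eq_taylor, coeff_taylor_of_natDegree_le_succ (hmap g).le,
          coeff_map, RingHom.coe_coe, hlead] at hg
        linear_combination hg
      have hcoeff : q.coeff (n + 1) = 0 :=
        (mul_eq_zero.mp (neg_eq_zero.mp hzero)).resolve_left n.cast_add_one_ne_zero
      have hq : q = 0 := by
        rwa [← Nat.succ_eq_add_one, ← hn, coeff_natDegree, leadingCoeff_eq_zero] at hcoeff
      simp [hq] at hne
    obtain ⟨c, rfl⟩ := natDegree_eq_zero.mp hdeg
    obtain ⟨a, rfl⟩ := (hfix c).mp fun g => by simpa [polyAct] using h g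
    exact ⟨a, rfl⟩
  · rintro ⟨a, rfl⟩ g
    simp [polyAct]
end

section
/- Let K ⊆ C be fields, let G be a group acting on C by K-algebra automorphisms, and let λ : G → (K,+) and χ : G → K^× be group homomorphisms. Let C(χ) denote the K-linear G-representation with underlying space C and action g·v = χ(g)·g(v), and for k ≥ 0 let A_k(χ) denote the K-linear G-representation whose underlying space is the space of polynomials in C[X] of degree ≤ k, with action g·(∑ aᵢXⁱ) = χ(g)·∑ g(aᵢ)(X+λ(g))ⁱ. Assume that Hⁱ(G, C(χ)) = 0 for all i ≥ 0 (ordinary group cohomology of K-linear representations). Then Hⁱ(G, A_k(χ)) = 0 for all i ≥ 0 and all k ≥ 0. -/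
open Polynomial

universe u

open CategoryTheory

lemma coeff_polyAct_of_degree_le {K C : Type*} [Field K] [Field C] [Algebra K C]
    (σ : C ≃ₐ[K] C) (t : C) {q : Polynomial C} {n : ℕ} (hq : q.degree ≤ n) :
    (polyAct σ t q).coeff n = σ (q.coeff n) := by
  have hdeg : (q.map (σ : C →+* C)).natDegree ≤ n :=
    natDegree_map_le.trans (natDegree_le_of_degree_le hq)
  have htaylor : polyAct σ t q = taylor t (q.map (σ : C →+* C)) := (taylor_apply _ _).symm
  have hcoeff : (q.map (σ : C →+* C)).coeff n = σ (q.coeff n) := coeff_map _ _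
  rw [htaylor, ← hcoeff]
  rcases hdeg.eq_or_lt with rfl | hlt
  · exact coeff_taylor_natDegree _ _
  · rw [coeff_eq_zero_of_natDegree_lt hlt,
      coeff_eq_zero_of_natDegree_lt (by rwa [natDegree_taylor])]

/-- The `n`-th coefficient of polynomials of degree at most `n`, as a map linear over a
subfield of scalars. -/
noncomputable def degreeLECoeff (K C : Type*) [Field K] [Field C] [Algebra K C] (n : ℕ) :
    Polynomial.degreeLE C (n : ℕ) →ₗ[K] C :=
  ((lcoeff C n).comp (Submodule.subtype _)).restrictScalars K

lemma degreeLECoeff_apply {K C : Type*} [Field K] [Field C] [Algebra K C] {n : ℕ}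
    (q : Polynomial.degreeLE C (n : ℕ)) :
    degreeLECoeff K C n q = (q : Polynomial C).coeff n := rfl

lemma degreeLECoeff_surjective (K C : Type*) [Field K] [Field C] [Algebra K C] (n : ℕ) :
    Function.Surjective (degreeLECoeff K C n) := fun c =>
  ⟨⟨monomial n c, mem_degreeLE.2 (degree_monomial_le n c)⟩, coeff_monomial_same n c⟩

lemma degreeLECoeff_zero_injective (K C : Type*) [Field K] [Field C] [Algebra K C] :
    Function.Injective (degreeLECoeff K C 0) := by
  intro p q h
  have hp := eq_C_of_degree_le_zero (mem_degreeLE.1 p.2)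
  have hq := eq_C_of_degree_le_zero (mem_degreeLE.1 q.2)
  rw [degreeLECoeff_apply, degreeLECoeff_apply] at h
  exact Subtype.ext (by rw [hp, hq, h])

/-- The inclusion of polynomials of degree at most `n` in those of degree at most `n + 1`. -/
noncomputable def degreeLESuccInclusion (K C : Type*) [Field K] [Field C] [Algebra K C] (n : ℕ) :
    Polynomial.degreeLE C (n : ℕ) →ₗ[K] Polynomial.degreeLE C (n + 1 : ℕ) :=
  (Submodule.inclusion (degreeLE_mono (by exact_mod_cast n.le_succ))).restrictScalars K

lemma coe_degreeLESuccInclusion {K C : Type*} [Field K] [Field C] [Algebra K C] {n : ℕ}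
    (q : Polynomial.degreeLE C (n : ℕ)) :
    (degreeLESuccInclusion K C n q : Polynomial C) = q := by
  rw [degreeLESuccInclusion, LinearMap.coe_restrictScalars, Submodule.coe_inclusion]

lemma degreeLESuccInclusion_injective
    (K C : Type*) [Field K] [Field C] [Algebra K C] (n : ℕ) :
    Function.Injective (degreeLESuccInclusion K C n) := by
  rw [degreeLESuccInclusion, LinearMap.coe_restrictScalars]
  exact Submodule.inclusion_injective _

lemma exact_degreeLESuccInclusion_degreeLECoeff
    (K C : Type*) [Field K] [Field C] [Algebra K C] (n : ℕ) :
    Function.Exact (degreeLESuccInclusion K C n) (degreeLECoeff K C (n + 1)) := by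
  intro q
  rw [degreeLECoeff_apply]
  constructor
  · intro h
    have hq : (q : Polynomial C).degree ≤ n := by
      rw [degree_le_iff_coeff_zero]
      intro m hm
      rcases (Nat.succ_le_of_lt (by exact_mod_cast hm : n < m)).eq_or_lt with rfl | hlt
      · exact h
      · exact coeff_eq_zero_of_degree_lt
          ((mem_degreeLE.1 q.2).trans_lt (by exact_mod_cast hlt))
    exact ⟨⟨q, mem_degreeLE.2 hq⟩, Subtype.ext (coe_degreeLESuccInclusion _)⟩
  · rintro ⟨p, rfl⟩
    rw [coe_degreeLESuccInclusion]
    exact coeff_eq_zero_of_degree_lt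
      ((mem_degreeLE.1 p.2).trans_lt (by exact_mod_cast n.lt_succ_self))

lemma Rep.shortExact_of_function_exact {k G : Type u} [CommRing k] [Group G]
    (S : ShortComplex (Rep.{u} k G)) (hexact : Function.Exact S.f.hom S.g.hom)
    (hf : Function.Injective S.f.hom) (hg : Function.Surjective S.g.hom) : S.ShortExact where
  exact := by
    apply (forget₂ _ (ModuleCat k)).reflects_exact_of_faithful
    exact ModuleCat.shortComplex_exact _ hexact
  mono_f := (Rep.mono_iff_injective _).2 hf
  epi_g := (Rep.epi_iff_surjective _).2 hg

namespace groupCohomology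

variable {k G U V W : Type u} [CommRing k] [Group G] [AddCommGroup U] [Module k U]
  [AddCommGroup V] [Module k V] [AddCommGroup W] [Module k W]
  {ρU : Representation k G U} {ρV : Representation k G V} {ρW : Representation k G W}

/-- The cohomology of an extension of representations vanishes in any degree in which that of
the sub and of the quotient vanish. -/
lemma subsingleton_of_exact (f : ρU.IntertwiningMap ρV) (g : ρV.IntertwiningMap ρW)
    (hexact : Function.Exact f g) (hf : Function.Injective f) (hg : Function.Surjective g)
    (i : ℕ) (hU : Subsingleton (groupCohomology (Rep.of ρU) i))
    (hW : Subsingleton (groupCohomology (Rep.of ρW) i)) :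
    Subsingleton (groupCohomology (Rep.of ρV) i) := by
  let S : ShortComplex (Rep.{u} k G) :=
    ShortComplex.mk (Rep.ofHom f) (Rep.ofHom g) <| by
      ext x
      exact hexact.apply_apply_eq_zero x
  have hS : S.ShortExact := Rep.shortExact_of_function_exact S hexact hf hg
  exact ModuleCat.subsingleton_of_isZero <|
    (mapShortComplex₂_exact hS i).isZero_X₂
      ((ModuleCat.isZero_of_subsingleton (groupCohomology (Rep.of ρU) i)).eq_zero_of_src _)
      ((ModuleCat.isZero_of_subsingleton (groupCohomology (Rep.of ρW) i)).eq_zero_of_tgt _)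

lemma subsingleton_of_bijective (f : ρU.IntertwiningMap ρV) (hf : Function.Bijective f) (i : ℕ)
    (hV : Subsingleton (groupCohomology (Rep.of ρV) i)) :
    Subsingleton (groupCohomology (Rep.of ρU) i) := by
  have := (Rep.mono_iff_injective (Rep.ofHom f)).2 hf.1
  have := (Rep.epi_iff_surjective (Rep.ofHom f)).2 hf.2
  have := isIso_of_mono_of_epi (Rep.ofHom f)
  exact ModuleCat.subsingleton_of_isZero <|
    (ModuleCat.isZero_of_subsingleton (groupCohomology (Rep.of ρV) i)).of_iso
      ((functor k G i).mapIso (asIso (Rep.ofHom f)))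

end groupCohomology

/-- Let `K ⊆ C` be fields, `G` a group acting on `C` by `K`-algebra automorphisms,
`λ : G → (K,+)` and `χ : G → K^×` homomorphisms.  Let `C(χ)` be the `K`-linear
`G`-representation `g·v = χ(g)·g(v)` on `C`, and `A_k(χ)` the representation on
polynomials of degree `≤ k` given by `g·(∑ aᵢXⁱ) = χ(g)·∑ g(aᵢ)(X+λ(g))ⁱ`.
If `Hⁱ(G, C(χ)) = 0` for all `i`, then `Hⁱ(G, A_k(χ)) = 0` for all `i` and `k`. -/
theorem twisted_polynomial_cohomology_vanishing
    {K C G : Type u} [Field K] [Field C] [Algebra K C] [Group G]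
    (ρ : G →* (C ≃ₐ[K] C))
    (l : G → K) (hl : ∀ g h : G, l (g * h) = l g + l h)
    (χ : G →* Kˣ)
    (ρC : Representation K G C)
    (hρC : ∀ (g : G) (v : C), ρC g v = (χ g : K) • (ρ g v))
    (ρA : ∀ k : ℕ, Representation K G (Polynomial.degreeLE C (k : ℕ)))
    (hρA : ∀ (k : ℕ) (g : G) (q : Polynomial.degreeLE C (k : ℕ)),
      ((ρA k g q : Polynomial C)) =
        (χ g : K) • polyAct (ρ g) (algebraMap K C (l g)) (q : Polynomial C))
    (hvan : ∀ i : ℕ, Subsingleton (groupCohomology (Rep.of ρC) i)) :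
    ∀ (i k : ℕ), Subsingleton (groupCohomology (Rep.of (ρA k)) i) := by
  intro i k
  have hcoeff (n : ℕ) (g : G) (q : Polynomial.degreeLE C (n : ℕ)) :
      degreeLECoeff K C n (ρA n g q) = ρC g (degreeLECoeff K C n q) := by
    rw [degreeLECoeff_apply, hρA, coeff_smul,
      coeff_polyAct_of_degree_le _ _ (mem_degreeLE.1 q.2), hρC, degreeLECoeff_apply]
  have hincl (n : ℕ) (g : G) (q : Polynomial.degreeLE C (n : ℕ)) :
      degreeLESuccInclusion K C n (ρA n g q) =
        ρA (n + 1) g (degreeLESuccInclusion K C n q) :=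
    Subtype.ext (by simp only [coe_degreeLESuccInclusion, hρA])
  let coeffHom (n : ℕ) : (ρA n).IntertwiningMap ρC :=
    LinearMap.intertwiningMap_of_isIntertwiningMap _ _ _ (hcoeff n)
  let inclHom (n : ℕ) : (ρA n).IntertwiningMap (ρA (n + 1)) :=
    LinearMap.intertwiningMap_of_isIntertwiningMap _ _ _ (hincl n)
  induction k with
  | zero =>
    exact groupCohomology.subsingleton_of_bijective (coeffHom 0)
      ⟨degreeLECoeff_zero_injective K C, degreeLECoeff_surjective K C 0⟩ i (hvan i)
  | succ n ih =>
    exact groupCohomology.subsingleton_of_exact (inclHom n) (coeffHom (n + 1))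
      (exact_degreeLESuccInclusion_degreeLECoeff K C n) (degreeLESuccInclusion_injective K C n)
      (degreeLECoeff_surjective K C (n + 1)) i ih (hvan i)
end

section
/- Let E be a field, σ a ring automorphism of E, and p a nonzero element of E. Let M be a finite-dimensional E-vector space equipped with a bijective additive σ-semilinear map φ : M → M and a nilpotent E-linear map N : M → M satisfying N ∘ φ = p·(φ ∘ N). Assume that for every pair of φ-stable E-subspaces U ⊆ V of M there exists a φ-stable E-subspace U′ ⊆ V with V = U ⊕ U′. Then there exist an integer k ≥ 1 with N^k = 0 and φ-stable E-subspaces W¹, …, Wᵏ of M such that: Wʲ ⊆ ker(Nʲ) for each j; the restriction of N^{j−1} to Wʲ is injective for each j; M is the internal direct sum M = ⊕_{j=1}^{k} ⊕_{i=0}^{j−1} Nⁱ(Wʲ); each subspace Nⁱ(Wʲ) is φ-stable; and N maps Nⁱ(Wʲ) bijectively onto Nⁱ⁺¹(Wʲ) for all 0 ≤ i ≤ j−2. -/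
/-- Complements of `ker N ^ j + N (ker N ^ (j + 2))` in `ker N ^ (j + 1)`: the primitive vectors
generating the Jordan chains of length `j + 1` of the endomorphism `N`. -/
structure IsPrimitiveFamily {R M : Type*} [Ring R] [AddCommGroup M] [Module R M]
    (N : M →ₗ[R] M) (W : ℕ → Submodule R M) : Prop where
  le_ker : ∀ j, W j ≤ LinearMap.ker (N ^ (j + 1))
  inf_eq_bot : ∀ j, (LinearMap.ker (N ^ j) ⊔ (LinearMap.ker (N ^ (j + 2))).map N) ⊓ W j = ⊥
  sup_eq_ker : ∀ j, (LinearMap.ker (N ^ j) ⊔ (LinearMap.ker (N ^ (j + 2))).map N) ⊔ W j =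
    LinearMap.ker (N ^ (j + 1))

namespace IsPrimitiveFamily

variable {R M : Type*} [Ring R] [AddCommGroup M] [Module R M]
  {N : M →ₗ[R] M} {W : ℕ → Submodule R M}

theorem pow_apply_eq_zero (hW : IsPrimitiveFamily N W) {j n : ℕ} (hn : j < n) {x : M}
    (hx : x ∈ W j) : (N ^ n) x = 0 :=
  Module.End.pow_map_zero_of_le hn (hW.le_ker j hx)

theorem eq_zero_of_pow_add_apply (hW : IsPrimitiveFamily N W) {j : ℕ} {x y : M} (hx : x ∈ W j)
    (hy : (N ^ (j + 2)) y = 0) (hxy : (N ^ j) (x + N y) = 0) : x = 0 := by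
  rw [← Submodule.mem_bot R, ← hW.inf_eq_bot j]
  refine ⟨?_, hx⟩
  rw [SetLike.mem_coe, ← add_sub_cancel_right x (N y)]
  exact Submodule.sub_mem _ (Submodule.mem_sup_left hxy)
    (Submodule.mem_sup_right (Submodule.mem_map_of_mem hy))

theorem eq_zero_of_pow_apply (hW : IsPrimitiveFamily N W) {j : ℕ} {x : M} (hx : x ∈ W j)
    (h : (N ^ j) x = 0) : x = 0 :=
  hW.eq_zero_of_pow_add_apply (y := 0) hx (map_zero _) (by simpa using h)

/-- The socles `N ^ j (W j)` are linearly independent. -/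
theorem eq_zero_of_sum_pow_apply (hW : IsPrimitiveFamily N W) {k : ℕ} {f : ℕ → M}
    (hf : ∀ j, f j ∈ W j) (h : ∑ j ∈ Finset.range k, (N ^ j) (f j) = 0) :
    ∀ j < k, f j = 0 := by
  intro j
  induction j using Nat.strong_induction_on with
  | _ j ih =>
    intro hj
    refine hW.eq_zero_of_pow_add_apply (hf j)
      (y := ∑ i ∈ Finset.Ico (j + 1) k, (N ^ (i - (j + 1))) (f i)) ?_ ?_
    · rw [map_sum]
      refine Finset.sum_eq_zero fun i hi => ?_
      rw [Finset.mem_Ico] at hi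
      rw [← Module.End.mul_apply, ← pow_add]
      exact hW.pow_apply_eq_zero (by lia) (hf i)
    · have hlow : ∑ i ∈ Finset.range j, (N ^ i) (f i) = 0 := by
        refine Finset.sum_eq_zero fun i hi => ?_
        rw [Finset.mem_range] at hi
        rw [ih i hi (hi.trans hj), map_zero]
      rw [← h, ← Finset.sum_range_add_sum_Ico _ hj.le, hlow, zero_add,
        Finset.sum_eq_sum_Ico_succ_bot hj, map_add, map_sum, map_sum]
      refine congrArg _ (Finset.sum_congr rfl fun i hi => ?_)
      rw [Finset.mem_Ico] at hi
      rw [← Module.End.mul_apply, ← Module.End.mul_apply, ← pow_succ, ← pow_add]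
      congr 2
      lia

/-- The subspaces `N ^ i (W j)` with `i ≤ j` are linearly independent. -/
theorem eq_zero_of_sum_sum_pow_apply (hW : IsPrimitiveFamily N W) {k : ℕ} {w : ℕ → ℕ → M}
    (hw : ∀ j i, w j i ∈ W j)
    (h : ∑ j ∈ Finset.range k, ∑ i ∈ Finset.range (j + 1), (N ^ i) (w j i) = 0) :
    ∀ j < k, ∀ i ≤ j, w j i = 0 := by
  suffices H : ∀ e d, k ≤ d + e → ∀ j < k, ∀ i ≤ j, d ≤ j - i → w j i = 0 from
    fun j hj i hi => H k 0 (by lia) j hj i hi (Nat.zero_le _)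
  intro e
  induction e with
  | zero => intros; lia
  | succ e ih =>
    intro d hd j hj i hi hdi
    rcases hdi.lt_or_eq with hlt | heq
    · exact ih (d + 1) (by lia) j hj i hi hlt
    have key := hW.eq_zero_of_sum_pow_apply (k := k)
      (f := fun j => if d ≤ j then w j (j - d) else 0)
      (fun j => by
        split_ifs
        exacts [hw _ _, Submodule.zero_mem _]) (by
        refine Eq.trans ?_ ((congrArg (N ^ d) h).trans (map_zero _))
        rw [map_sum]
        refine Finset.sum_congr rfl fun j hj => ?_
        rw [Finset.mem_range] at hj
        have hterm : ∀ i ∈ Finset.range (j + 1), i + d ≠ j → (N ^ d) ((N ^ i) (w j i)) = 0 := by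
          intro i hi hne
          rw [Finset.mem_range] at hi
          rcases hne.lt_or_gt with hlt | hgt
          · rw [ih (d + 1) (by lia) j hj i (by lia) (by lia), map_zero, map_zero]
          · rw [← Module.End.mul_apply, ← pow_add]
            exact hW.pow_apply_eq_zero (by lia) (hw j i)
        rw [map_sum]
        split_ifs with hdj
        · rw [Finset.sum_eq_single_of_mem (j - d) (by simp)
            fun i hi hne => hterm i hi (by lia), ← Module.End.mul_apply, ← pow_add,
            Nat.add_sub_cancel' hdj]
        · rw [map_zero, Finset.sum_eq_zero fun i hi => hterm i hi (by lia)]) j hj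
    rw [if_pos (by lia), show j - d = i by lia] at key
    exact key

/-- The subspaces `N ^ i (W j)` with `i ≤ j < k` span the whole space if `N ^ k = 0`. -/
theorem iSup_map_pow_eq_top (hW : IsPrimitiveFamily N W) {k : ℕ} (hk : N ^ k = 0) :
    ⨆ q : Σ j : Fin k, Fin ((j : ℕ) + 1), (W q.1).map (N ^ (q.2 : ℕ)) = ⊤ := by
  set S := ⨆ q : Σ j : Fin k, Fin ((j : ℕ) + 1), (W q.1).map (N ^ (q.2 : ℕ)) with hS
  have hmem : ∀ j < k, ∀ i ≤ j, (W j).map (N ^ i) ≤ S := fun j hj i hi =>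
    le_iSup (fun q : Σ j : Fin k, Fin ((j : ℕ) + 1) => (W q.1).map (N ^ (q.2 : ℕ)))
      ⟨⟨j, hj⟩, ⟨i, Nat.lt_succ_of_le hi⟩⟩
  have hNS : S.map N ≤ S := by
    rw [hS, Submodule.map_iSup]
    refine iSup_le ?_
    rintro ⟨⟨j, hj⟩, ⟨i, hi⟩⟩
    rw [← Submodule.map_comp, ← Module.End.mul_eq_comp, ← pow_succ']
    rcases (Nat.le_of_lt_succ hi).lt_or_eq with hlt | rfl
    · exact hmem j hj (i + 1) hlt
    · exact (LinearMap.le_ker_iff_map.1 (hW.le_ker _)).trans_le bot_le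
  have hstep : ∀ e j, k ≤ j + e → LinearMap.ker (N ^ (j + 1)) ≤ LinearMap.ker (N ^ j) ⊔ S := by
    intro e
    induction e with
    | zero =>
      intro j hj
      rw [pow_eq_zero_of_le (m := k) (n := j) hj hk, LinearMap.ker_zero, top_sup_eq]
      exact le_top
    | succ e ih =>
      intro j hj
      rcases le_or_gt k j with hkj | hjk
      · exact ih j (by lia)
      rw [← hW.sup_eq_ker j]
      refine sup_le (sup_le le_sup_left ?_) (le_sup_of_le_right ?_)
      · refine (Submodule.map_mono (ih (j + 1) (by lia))).trans ?_
        rw [Submodule.map_sup]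
        refine sup_le_sup ?_ hNS
        rintro _ ⟨x, hx, rfl⟩
        rwa [LinearMap.mem_ker, ← Module.End.mul_apply, ← pow_succ]
      · simpa [Module.End.one_eq_id] using hmem j hjk 0 (Nat.zero_le _)
  have hker : ∀ j, LinearMap.ker (N ^ j) ≤ S := by
    intro j
    induction j with
    | zero => simp [Module.End.one_eq_id]
    | succ j ih => exact (hstep k j (by lia)).trans (sup_le ih le_rfl)
  rw [eq_top_iff]
  simpa [hk] using hker k

theorem isInternal (hW : IsPrimitiveFamily N W) {k : ℕ} (hk : N ^ k = 0) :
    DirectSum.IsInternal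
      (fun q : Σ j : Fin k, Fin ((j : ℕ) + 1) => (W q.1).map (N ^ (q.2 : ℕ))) := by
  refine (DirectSum.isInternal_submodule_iff_iSupIndep_and_iSup_eq_top _).2
    ⟨?_, hW.iSup_map_pow_eq_top hk⟩
  rw [iSupIndep_iff_dfinsupp_lsum_injective, ← LinearMap.ker_eq_bot, LinearMap.ker_eq_bot']
  intro m hm
  choose v hvW hv using fun q => (m q).2
  let w : ℕ → ℕ → M := fun j i =>
    if h : j < k ∧ i < j + 1 then v ⟨⟨j, h.1⟩, ⟨i, h.2⟩⟩ else 0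
  have hwv : ∀ (j : Fin k) (i : Fin ((j : ℕ) + 1)), w j i = v ⟨j, i⟩ := fun j i =>
    dif_pos ⟨j.2, i.2⟩
  have hw : ∀ j i, w j i ∈ W j := fun j i => by
    by_cases h : j < k ∧ i < j + 1
    · simpa only [w, dif_pos h, SetLike.mem_coe] using hvW ⟨⟨j, h.1⟩, ⟨i, h.2⟩⟩
    · simp only [w, dif_neg h, Submodule.zero_mem]
  have hsum : ∑ j ∈ Finset.range k, ∑ i ∈ Finset.range (j + 1), (N ^ i) (w j i) = 0 := by
    classical
    rw [← hm, DFinsupp.lsum_apply_apply, DFinsupp.sumAddHom_apply,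
      DFinsupp.sum_eq_sum_fintype _ (fun _ => map_zero _), Fintype.sum_sigma, Finset.sum_range]
    refine Finset.sum_congr rfl fun j _ => ?_
    rw [Finset.sum_range]
    refine Finset.sum_congr rfl fun i _ => ?_
    rw [hwv]
    exact hv ⟨j, i⟩
  ext ⟨j, i⟩
  rw [← hv, ← hwv, hW.eq_zero_of_sum_sum_pow_apply hw hsum j j.2 i (Nat.le_of_lt_succ i.2)]
  simp

end IsPrimitiveFamily

section FrobeniusStable

variable {E : Type*} [Field E] {p : E} {M : Type*} [AddCommGroup M] [Module E M]
  {φ : M ≃+ M} {N : M →ₗ[E] M}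

theorem pow_apply_frobenius (hNφ : ∀ m : M, N (φ m) = p • φ (N m)) (n : ℕ) (m : M) :
    (N ^ n) (φ m) = p ^ n • φ ((N ^ n) m) := by
  induction n generalizing m with
  | zero => simp
  | succ n ih =>
    rw [pow_succ, Module.End.mul_apply, hNφ, map_smul, ih, smul_smul, Module.End.mul_apply,
      ← pow_succ']

theorem frobenius_mem_ker_pow (hNφ : ∀ m : M, N (φ m) = p • φ (N m)) (n : ℕ) {x : M}
    (hx : x ∈ LinearMap.ker (N ^ n)) : φ x ∈ LinearMap.ker (N ^ n) := by
  rw [LinearMap.mem_ker] at hx ⊢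
  rw [pow_apply_frobenius hNφ, hx, map_zero, smul_zero]

theorem frobenius_mem_map_pow (hp : p ≠ 0) (hNφ : ∀ m : M, N (φ m) = p • φ (N m))
    {V : Submodule E M} (hV : ∀ x ∈ V, φ x ∈ V) (n : ℕ) :
    ∀ x ∈ V.map (N ^ n), φ x ∈ V.map (N ^ n) := by
  rintro _ ⟨x, hx, rfl⟩
  rw [← inv_smul_smul₀ (pow_ne_zero n hp) (φ _), ← pow_apply_frobenius hNφ]
  exact Submodule.smul_mem _ _ (Submodule.mem_map_of_mem (hV x hx))

theorem frobenius_mem_sup {U V : Submodule E M} (hU : ∀ x ∈ U, φ x ∈ U)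
    (hV : ∀ x ∈ V, φ x ∈ V) : ∀ x ∈ U ⊔ V, φ x ∈ U ⊔ V := by
  intro x hx
  obtain ⟨u, hu, v, hv, rfl⟩ := Submodule.mem_sup.1 hx
  rw [map_add]
  exact Submodule.add_mem_sup (hU u hu) (hV v hv)

theorem exists_isPrimitiveFamily_frobenius_stable (hp : p ≠ 0)
    (hNφ : ∀ m : M, N (φ m) = p • φ (N m))
    (hcompl : ∀ U V : Submodule E M,
      (∀ x ∈ U, φ x ∈ U) → (∀ x ∈ V, φ x ∈ V) → U ≤ V →
      ∃ U' : Submodule E M,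
        (∀ x ∈ U', φ x ∈ U') ∧ U' ≤ V ∧ U ⊓ U' = ⊥ ∧ U ⊔ U' = V) :
    ∃ W : ℕ → Submodule E M, IsPrimitiveFamily N W ∧ ∀ j, ∀ x ∈ W j, φ x ∈ W j := by
  have hle : ∀ j, LinearMap.ker (N ^ j) ⊔ (LinearMap.ker (N ^ (j + 2))).map N ≤
      LinearMap.ker (N ^ (j + 1)) := by
    refine fun j => sup_le (fun x hx => Module.End.pow_map_zero_of_le j.le_succ hx) ?_
    rintro _ ⟨x, hx, rfl⟩
    rwa [LinearMap.mem_ker, ← Module.End.mul_apply, ← pow_succ]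
  have hmap : ∀ j, ∀ x ∈ (LinearMap.ker (N ^ j)).map N, φ x ∈ (LinearMap.ker (N ^ j)).map N :=
    fun j => by
      simpa only [pow_one] using
        frobenius_mem_map_pow hp hNφ (fun _ => frobenius_mem_ker_pow hNφ j) 1
  choose W hφW hWle hinf hsup using fun j => hcompl _ _
    (frobenius_mem_sup (fun _ => frobenius_mem_ker_pow hNφ j) (hmap (j + 2)))
    (fun _ => frobenius_mem_ker_pow hNφ (j + 1)) (hle j)
  exact ⟨W, ⟨hWle, hinf, hsup⟩, hφW⟩

end FrobeniusStable

/-- Explicit Krull–Schmidt-type decomposition of a `(φ, N)`-module: let `E` be a field,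
`σ` a ring automorphism of `E`, `p ≠ 0` in `E`, and `M` a finite-dimensional `E`-vector
space with a bijective additive `σ`-semilinear map `φ` and a nilpotent `E`-linear map
`N` with `N ∘ φ = p • (φ ∘ N)`.  If every `φ`-stable subspace of a `φ`-stable subspace
admits a `φ`-stable complement, then `M` decomposes as
`M = ⊕_{j=1}^{k} ⊕_{i=0}^{j−1} Nⁱ(Wʲ)` with `Wʲ ⊆ ker Nʲ`, `N^{j−1}` injective on `Wʲ`,
each `Nⁱ(Wʲ)` being `φ`-stable, and `N` mapping `Nⁱ(Wʲ)` bijectively onto `Nⁱ⁺¹(Wʲ)`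
for `0 ≤ i ≤ j−2`.  (Here `W j` for `j : Fin k` denotes `W^{j+1}`.) -/
theorem phiN_module_decomposition
    {E : Type*} [Field E] (σ : E ≃+* E) (p : E) (hp : p ≠ 0)
    {M : Type*} [AddCommGroup M] [Module E M] [FiniteDimensional E M]
    (φ : M ≃+ M) (hφ : ∀ (a : E) (m : M), φ (a • m) = σ a • φ m)
    (N : M →ₗ[E] M) (hNnil : IsNilpotent N)
    (hNφ : ∀ m : M, N (φ m) = p • φ (N m))
    (hcompl : ∀ U V : Submodule E M,
      (∀ x ∈ U, φ x ∈ U) → (∀ x ∈ V, φ x ∈ V) → U ≤ V →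
      ∃ U' : Submodule E M,
        (∀ x ∈ U', φ x ∈ U') ∧ U' ≤ V ∧ U ⊓ U' = ⊥ ∧ U ⊔ U' = V) :
    ∃ k : ℕ, 1 ≤ k ∧ N ^ k = 0 ∧
      ∃ W : Fin k → Submodule E M,
        -- each `Wʲ` is `φ`-stable
        (∀ j : Fin k, ∀ x ∈ W j, φ x ∈ W j) ∧
        -- `Wʲ ⊆ ker Nʲ`
        (∀ j : Fin k, W j ≤ LinearMap.ker (N ^ ((j : ℕ) + 1))) ∧
        -- `N^{j−1}` restricted to `Wʲ` is injective
        (∀ j : Fin k, ∀ x ∈ W j, (N ^ (j : ℕ)) x = 0 → x = 0) ∧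
        -- `M = ⊕_{j=1}^{k} ⊕_{i=0}^{j−1} Nⁱ(Wʲ)` (internal direct sum)
        DirectSum.IsInternal
          (fun q : Σ j : Fin k, Fin ((j : ℕ) + 1) =>
            Submodule.map (N ^ (q.2 : ℕ)) (W q.1)) ∧
        -- each `Nⁱ(Wʲ)` is `φ`-stable
        (∀ (j : Fin k) (i : Fin ((j : ℕ) + 1)),
          ∀ x ∈ Submodule.map (N ^ (i : ℕ)) (W j),
            φ x ∈ Submodule.map (N ^ (i : ℕ)) (W j)) ∧
        -- `N` maps `Nⁱ(Wʲ)` bijectively onto `Nⁱ⁺¹(Wʲ)` for `0 ≤ i ≤ j−2`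
        (∀ (j : Fin k) (i : ℕ), i + 2 ≤ (j : ℕ) + 1 →
          Submodule.map N (Submodule.map (N ^ i) (W j)) =
            Submodule.map (N ^ (i + 1)) (W j) ∧
          ∀ x ∈ Submodule.map (N ^ i) (W j), N x = 0 → x = 0) := by
  obtain ⟨W, hW, hφW⟩ := exists_isPrimitiveFamily_frobenius_stable hp hNφ hcompl
  obtain ⟨n, hn⟩ := hNnil
  have hk : N ^ (n + 1) = 0 := pow_eq_zero_of_le n.le_succ hn
  refine ⟨n + 1, n.succ_pos, hk, fun j => W j, fun j => hφW j, fun j => hW.le_ker j,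
    fun j x hx => hW.eq_zero_of_pow_apply hx, hW.isInternal hk,
    fun j i => frobenius_mem_map_pow hp hNφ (hφW j) i, fun j i hi => ⟨?_, ?_⟩⟩
  · rw [← Submodule.map_comp, ← Module.End.mul_eq_comp, ← pow_succ']
  · rintro _ ⟨x, hx, rfl⟩ h0
    rw [← Module.End.mul_apply, ← pow_succ'] at h0
    rw [hW.eq_zero_of_pow_apply hx (Module.End.pow_map_zero_of_le (by lia) h0), map_zero]
end
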